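/- arXiv:1304.4365 — 3 statements merged into one kernel-verified Lean document; each statement's English description precedes it below -/
import Mathlib

section
/- (Gołąb semicontinuity theorem.) Let d ≥ 1 and let (K_n) be a sequence of nonempty compact connected subsets of ℝ^d converging in Hausdorff distance to a nonempty compact set K. Then the one-dimensional Hausdorff measure is lower semicontinuous along this sequence: H¹(K) ≤ liminf_{n→∞} H¹(K_n). -/
open scoped MeasureTheory NNReal ENNReal Topology
open Metric Set Filter MeasureTheory

/-- `GraftedTree adj r S` says that the finite set `S` is built from singletons by grafting trees:
a tree rooted at `s` is attached to the root `r` of a disjoint tree whenever `adj r s`. -/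
inductive GraftedTree {ι : Type*} [DecidableEq ι] (adj : ι → ι → Prop) : ι → Finset ι → Prop
  | single (r : ι) : GraftedTree adj r {r}
  | graft {r s : ι} {S T : Finset ι} (hS : GraftedTree adj r S) (hT : GraftedTree adj s T)
      (hST : Disjoint S T) (hrs : adj r s) : GraftedTree adj r (S ∪ T)

namespace GraftedTree

variable {ι : Type*} [DecidableEq ι] {adj : ι → ι → Prop}

theorem insert_leaf {r : ι} {S : Finset ι} (h : GraftedTree adj r S) {v s : ι} (hv : v ∈ S)
    (hs : s ∉ S) (hvs : adj v s) : GraftedTree adj r (insert s S) := by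
  induction h with
  | single r =>
    obtain rfl : v = r := by simpa using hv
    rw [← Finset.union_singleton]
    exact .graft (.single v) (.single s) (by simpa [eq_comm] using hs) hvs
  | graft hS hT hST hrs ihS ihT =>
    rw [Finset.mem_union, not_or] at hs
    rcases Finset.mem_union.1 hv with hv | hv
    · rw [← Finset.insert_union]
      exact .graft (ihS hv hs.1) hT (Finset.disjoint_insert_left.2 ⟨hs.2, hST⟩) hrs
    · rw [← Finset.union_insert]
      exact .graft hS (ihT hv hs.2) (Finset.disjoint_insert_right.2 ⟨hs.1, hST⟩) hrs

/-- A finite set in which every proper nonempty subset has an outgoing edge is a grafted tree. -/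
theorem of_forall_exists_adj {s : Finset ι} {r : ι} (hr : r ∈ s)
    (h : ∀ S ⊂ s, S.Nonempty → ∃ v ∈ S, ∃ u ∈ s \ S, adj v u) : GraftedTree adj r s := by
  classical
  obtain ⟨S, hS, hmax⟩ := (s.powerset.filter (GraftedTree adj r)).exists_max_image Finset.card
    ⟨{r}, by simp [hr, GraftedTree.single]⟩
  simp only [Finset.mem_filter, Finset.mem_powerset] at hS hmax
  have hrS : ∀ {r : ι} {S : Finset ι}, GraftedTree adj r S → S.Nonempty := by
    intro r S h
    induction h with
    | single r => simp
    | graft _ _ _ _ ih _ => exact ih.mono Finset.subset_union_left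
  rcases hS.1.eq_or_ssubset with rfl | hlt
  · exact hS.2
  obtain ⟨v, hv, u, hu, hvu⟩ := h S hlt (hrS hS.2)
  rw [Finset.mem_sdiff] at hu
  have := hmax (insert u S) ⟨Finset.insert_subset hu.1 hS.1, hS.2.insert_leaf hv hu.2 hvu⟩
  rw [Finset.card_insert_of_notMem hu.2] at this
  omega

/-- The sets indexed by a tree of intersecting small sets can be grouped into few clusters of
diameter at most `2 * δ`, together with a residual cluster `R` around the root, at the cost of
counting one small set twice per cluster. -/
theorem exists_clusters {X : Type*} [PseudoEMetricSpace X] {U : ι → Set X} {w : ι → ℝ≥0}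
    {δ η : ℝ≥0} (hηδ : η ≤ δ) (hU : ∀ i, ediam (U i) ≤ w i) (hw : ∀ i, w i ≤ η)
    {r : ι} {S : Finset ι} (h : GraftedTree (fun i j => (U i ∩ U j).Nonempty) r S) :
    ∃ (l : List (Set X)) (R : Set X) (σ ρ : ℝ≥0), (∀ A ∈ l, ediam A ≤ 2 * δ) ∧ U r ⊆ R ∧
      ediam R ≤ ρ ∧ ρ ≤ δ ∧ (∀ j ∈ S, ∀ x ∈ U j, x ∈ R ∨ ∃ A ∈ l, x ∈ A) ∧
      (l.map ediam).sum ≤ σ ∧ σ + ρ ≤ ∑ i ∈ S, w i + l.length * η ∧ l.length * δ ≤ σ := by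
  induction h with
  | single r =>
    exact ⟨[], U r, 0, w r, by simp, subset_rfl, hU r, (hw r).trans hηδ, by simp, by simp,
      by simp, by simp⟩
  | @graft r s S T _ _ hST hrs ihS ihT =>
    obtain ⟨l₁, R₁, σ₁, ρ₁, hl₁, hR₁, hd₁, hρ₁, hc₁, hs₁, hσ₁, hk₁⟩ := ihS
    obtain ⟨l₂, R₂, σ₂, ρ₂, hl₂, hR₂, hd₂, hρ₂, hc₂, hs₂, hσ₂, hk₂⟩ := ihT
    have hd : ediam (R₁ ∪ R₂) ≤ (ρ₁ + ρ₂ : ℝ≥0) := by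
      rw [ENNReal.coe_add]
      exact (ediam_union_le (hrs.mono (inter_subset_inter hR₁ hR₂))).trans (add_le_add hd₁ hd₂)
    have hl : ∀ A ∈ l₁ ++ l₂, ediam A ≤ 2 * δ := by
      intro A hA
      exact (List.mem_append.1 hA).elim (hl₁ A) (hl₂ A)
    have hc : ∀ j ∈ S ∪ T, ∀ x ∈ U j, x ∈ R₁ ∪ R₂ ∨ ∃ A ∈ l₁ ++ l₂, x ∈ A := by
      intro j hj x hx
      rcases Finset.mem_union.1 hj with hj | hj
      · rcases hc₁ j hj x hx with h | ⟨A, hA, hxA⟩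
        · exact .inl (.inl h)
        · exact .inr ⟨A, List.mem_append_left _ hA, hxA⟩
      · rcases hc₂ j hj x hx with h | ⟨A, hA, hxA⟩
        · exact .inl (.inr h)
        · exact .inr ⟨A, List.mem_append_right _ hA, hxA⟩
    have hs : ((l₁ ++ l₂).map ediam).sum ≤ (σ₁ + σ₂ : ℝ≥0) := by
      rw [List.map_append, List.sum_append, ENNReal.coe_add]
      exact add_le_add hs₁ hs₂
    rw [Finset.sum_union hST]
    by_cases hρ : ρ₁ + ρ₂ ≤ δ
    · refine ⟨l₁ ++ l₂, R₁ ∪ R₂, σ₁ + σ₂, ρ₁ + ρ₂, hl, hR₁.trans subset_union_left, hd, hρ, hc,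
        hs, ?_, ?_⟩
      · push_cast [List.length_append]
        linarith
      · push_cast [List.length_append]
        linarith
    · refine ⟨(R₁ ∪ R₂) :: (l₁ ++ l₂), U r, (ρ₁ + ρ₂) + (σ₁ + σ₂), w r, ?_, subset_rfl, hU r,
        (hw r).trans hηδ, ?_, ?_, ?_, ?_⟩
      · rw [List.forall_mem_cons]
        refine ⟨hd.trans ?_, hl⟩
        rw [two_mul]
        exact_mod_cast add_le_add hρ₁ hρ₂
      · intro j hj x hx
        rcases hc j hj x hx with h | ⟨A, hA, hxA⟩
        · exact .inr ⟨_, List.mem_cons_self, h⟩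
        · exact .inr ⟨A, List.mem_cons_of_mem _ hA, hxA⟩
      · rw [List.map_cons, List.sum_cons, ENNReal.coe_add]
        exact add_le_add hd hs
      · push_cast [List.length_append, List.length_cons]
        linarith [hw r]
      · push_cast [List.length_append, List.length_cons]
        linarith

end GraftedTree

/-- A compact set of finite length has a finite cover by small open sets of almost optimal total
diameter. -/
theorem IsCompact.exists_finset_cover_of_hausdorffMeasure_one_lt {X : Type*} [MetricSpace X]
    [MeasurableSpace X] [BorelSpace X] {K : Set X} (hK : IsCompact K) {C η : ℝ≥0}
    (hC : μH[1] K < C) (hη : 0 < η) :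
    ∃ (s : Finset ℕ) (U : ℕ → Set X) (w : ℕ → ℝ≥0), (∀ i, IsOpen (U i)) ∧
      (∀ i ∈ s, (K ∩ U i).Nonempty) ∧ K ⊆ ⋃ i ∈ s, U i ∧ (∀ i, ediam (U i) ≤ w i) ∧
      (∀ i, w i ≤ η) ∧ ∑ i ∈ s, w i ≤ C := by
  classical
  have hη2 : (0 : ℝ≥0∞) < (η / 2 : ℝ≥0) := by simpa using hη.ne'
  rw [Measure.hausdorffMeasure_apply] at hC
  have hinf := (le_iSup₂ (f := fun (r : ℝ≥0∞) (_ : 0 < r) =>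
    ⨅ (t : ℕ → Set X) (_ : K ⊆ ⋃ n, t n) (_ : ∀ n, ediam (t n) ≤ r),
      ∑' n, ⨆ _ : (t n).Nonempty, ediam (t n) ^ (1 : ℝ)) _ hη2).trans_lt hC
  simp only [iInf_lt_iff] at hinf
  obtain ⟨t, htK, htd, hts⟩ := hinf
  have hsup : ∀ n, (⨆ _ : (t n).Nonempty, ediam (t n) ^ (1 : ℝ)) = ediam (t n) := by
    intro n
    rcases (t n).eq_empty_or_nonempty with h | h <;> simp [h]
  simp only [hsup] at hts
  have hgap : min (((C : ℝ≥0∞) - ∑' n, ediam (t n)) / 2) (η / 4 : ℝ≥0) ≠ 0 := by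
    refine (lt_min (ENNReal.half_pos (tsub_pos_of_lt hts).ne') ?_).ne'
    simpa using hη.ne'
  obtain ⟨ε, hε, hεs⟩ := ENNReal.exists_pos_sum_of_countable hgap ℕ
  have hεη : ∀ i, ε i ≤ η / 4 := fun i =>
    ENNReal.coe_le_coe.1 ((ENNReal.le_tsum i).trans (hεs.le.trans (min_le_right _ _)))
  let U : ℕ → Set X := fun i => thickening (ε i) (t i)
  have hUd : ∀ i, ediam (U i) ≤ ediam (t i) + 2 * ε i := fun i => ediam_thickening_le _
  have hUη : ∀ i, ediam (U i) ≤ η := by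
    intro i
    refine ((hUd i).trans (add_le_add (htd i) (mul_le_mul_right
      (ENNReal.coe_le_coe.2 (hεη i)) 2))).trans ?_
    have : η / 2 + 2 * (η / 4) ≤ η := by
      rw [← NNReal.coe_le_coe]; push_cast; linarith
    exact_mod_cast this
  have hUtop : ∀ i, ediam (U i) ≠ ∞ := fun i => ((hUη i).trans_lt ENNReal.coe_lt_top).ne
  have hKU : K ⊆ ⋃ i, U i :=
    htK.trans (iUnion_mono fun i => self_subset_thickening (NNReal.coe_pos.2 (hε i)) _)
  obtain ⟨s, hs⟩ := hK.elim_finite_subcover U (fun i => isOpen_thickening) hKU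
  refine ⟨s.filter fun i => (K ∩ U i).Nonempty, U, fun i => (ediam (U i)).toNNReal,
    fun i => isOpen_thickening, fun i hi => (Finset.mem_filter.1 hi).2, ?_, ?_, ?_, ?_⟩
  · intro x hx
    obtain ⟨i, hi, hxi⟩ := mem_iUnion₂.1 (hs hx)
    exact mem_iUnion₂.2 ⟨i, Finset.mem_filter.2 ⟨hi, x, hx, hxi⟩, hxi⟩
  · intro i
    rw [ENNReal.coe_toNNReal (hUtop i)]
  · intro i
    exact ENNReal.coe_le_coe.1 (ENNReal.coe_toNNReal_le_self.trans (hUη i))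
  · rw [← ENNReal.coe_le_coe, ENNReal.ofNNReal_finsetSum]
    calc ∑ i ∈ s.filter fun i => (K ∩ U i).Nonempty, ((ediam (U i)).toNNReal : ℝ≥0∞)
        ≤ ∑ i ∈ s.filter fun i => (K ∩ U i).Nonempty, (ediam (t i) + 2 * ε i) :=
          Finset.sum_le_sum fun i _ => ENNReal.coe_toNNReal_le_self.trans (hUd i)
      _ ≤ ∑' i, (ediam (t i) + 2 * ε i) := ENNReal.sum_le_tsum _
      _ = ∑' i, ediam (t i) + 2 * ∑' i, (ε i : ℝ≥0∞) := by
          rw [ENNReal.tsum_add, ENNReal.tsum_mul_left]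
      _ ≤ ∑' i, ediam (t i) + 2 * (((C : ℝ≥0∞) - ∑' n, ediam (t n)) / 2) := by
          gcongr
          exact hεs.le.trans (min_le_left _ _)
      _ = C := by
          rw [ENNReal.mul_div_cancel two_ne_zero ENNReal.ofNat_ne_top,
            add_tsub_cancel_of_le hts.le]

/-- A continuum of length less than `C` is covered by boundedly many sets of diameter at most
`2 * δ` whose total diameter is almost at most `C`. -/
theorem IsConnected.exists_list_cover_of_hausdorffMeasure_one_lt {X : Type*} [MetricSpace X]
    [MeasurableSpace X] [BorelSpace X] {K : Set X} (hK : IsCompact K) (hconn : IsConnected K)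
    {C δ η : ℝ≥0} (hC : μH[1] K < C) (hη : 0 < η) (hηδ : η ≤ δ) :
    ∃ l : List (Set X), (∀ A ∈ l, ediam A ≤ 2 * δ) ∧ (∀ x ∈ K, ∃ A ∈ l, x ∈ A) ∧
      (l.map ediam).sum ≤ (C + l.length * η : ℝ≥0) ∧
      l.length * δ ≤ C + l.length * η + δ := by
  obtain ⟨s, U, w, hUo, hUK, hKs, hUw, hw, hsum⟩ :=
    hK.exists_finset_cover_of_hausdorffMeasure_one_lt hC hη
  obtain ⟨x₀, hx₀⟩ := hconn.nonempty
  obtain ⟨r, hr, -⟩ := mem_iUnion₂.1 (hKs hx₀)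
  have htree : GraftedTree (fun i j => (U i ∩ U j).Nonempty) r s := by
    refine GraftedTree.of_forall_exists_adj hr fun S hS hSne => ?_
    obtain ⟨a, ha⟩ := hSne
    obtain ⟨b, hb, hbS⟩ := Finset.exists_of_ssubset hS
    have hopen : ∀ T : Finset ℕ, IsOpen (⋃ i ∈ T, U i) := fun T =>
      isOpen_biUnion fun i _ => hUo i
    obtain ⟨x, -, hx₁, hx₂⟩ := hconn.isPreconnected (⋃ i ∈ S, U i) (⋃ i ∈ s \ S, U i)
      (hopen S) (hopen (s \ S))
      (by
        intro x hx
        obtain ⟨i, hi, hxi⟩ := mem_iUnion₂.1 (hKs hx)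
        by_cases hiS : i ∈ S
        · exact .inl (mem_iUnion₂.2 ⟨i, hiS, hxi⟩)
        · exact .inr (mem_iUnion₂.2 ⟨i, Finset.mem_sdiff.2 ⟨hi, hiS⟩, hxi⟩))
      ((hUK a (hS.1 ha)).mono (inter_subset_inter_right _
        (subset_biUnion_of_mem (u := U) (show a ∈ (S : Set ℕ) from ha))))
      ((hUK b hb).mono (inter_subset_inter_right _
        (subset_biUnion_of_mem (u := U)
          (show b ∈ ((s \ S : Finset ℕ) : Set ℕ) from Finset.mem_sdiff.2 ⟨hb, hbS⟩))))
    obtain ⟨i, hi, hxi⟩ := mem_iUnion₂.1 hx₁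
    obtain ⟨j, hj, hxj⟩ := mem_iUnion₂.1 hx₂
    exact ⟨i, hi, j, hj, x, hxi, hxj⟩
  obtain ⟨l, R, σ, ρ, hl, -, hR, hρ, hc, hs, hσ, hk⟩ := htree.exists_clusters hηδ hUw hw
  have hη0 := hη.le
  refine ⟨R :: l, ?_, ?_, ?_, ?_⟩
  · rw [List.forall_mem_cons]
    refine ⟨hR.trans ?_, hl⟩
    exact_mod_cast hρ.trans (le_mul_of_one_le_left (zero_le) one_le_two)
  · intro x hx
    obtain ⟨i, hi, hxi⟩ := mem_iUnion₂.1 (hKs hx)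
    rcases hc i hi x hxi with h | ⟨A, hA, hxA⟩
    · exact ⟨R, List.mem_cons_self, h⟩
    · exact ⟨A, List.mem_cons_of_mem _ hA, hxA⟩
  · rw [List.map_cons, List.sum_cons]
    refine (add_le_add hR hs).trans ?_
    rw [← ENNReal.coe_add, ENNReal.coe_le_coe]
    push_cast [List.length_cons]
    linarith
  · push_cast [List.length_cons]
    have : 0 ≤ ρ := zero_le
    linarith

/-- If a set lies within arbitrarily small distance of continua of length less than `C`,
then it has covers of arbitrarily small mesh with total diameter almost at most `C`. -/
theorem exists_list_cover_of_forall_exists_continuum {X : Type*} [MetricSpace X]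
    [MeasurableSpace X] [BorelSpace X] {L : Set X} {C δ : ℝ≥0} (hδ : 0 < δ)
    (h : ∀ τ : ℝ≥0, 0 < τ → ∃ K : Set X, IsCompact K ∧ IsConnected K ∧ μH[1] K < C ∧
      L ⊆ thickening τ K) :
    ∃ l : List (Set X), (∀ A ∈ l, ediam A ≤ 3 * δ) ∧ (∀ x ∈ L, ∃ A ∈ l, x ∈ A) ∧
      (l.map ediam).sum ≤ (C + δ : ℝ≥0) := by
  let M : ℝ≥0 := 2 * (C + δ) / δ + 1
  have hM1 : 1 ≤ M := le_add_of_nonneg_left (zero_le)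
  have hM : 0 < M := one_pos.trans_le hM1
  let τ : ℝ≥0 := δ / (3 * M)
  have hτ : 0 < τ := by positivity
  have hτM : 3 * (M * τ) = δ := by
    simp only [τ]; field_simp
  have hτδ : 3 * τ ≤ δ := by
    calc 3 * τ = 3 * (1 * τ) := by rw [one_mul]
      _ ≤ 3 * (M * τ) := by gcongr
      _ = δ := hτM
  have hτ0 := hτ.le
  obtain ⟨K, hK, hconn, hKC, hLK⟩ := h τ hτ
  obtain ⟨l, hl, hc, hs, hk⟩ := hconn.exists_list_cover_of_hausdorffMeasure_one_lt hK hKC hτ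
    (show τ ≤ δ by linarith)
  have hlen : (l.length : ℝ≥0) ≤ M := by
    have h3 : l.length * (3 * τ) ≤ l.length * δ := by gcongr
    have h0 : 0 ≤ l.length * δ := zero_le
    have : l.length * δ ≤ 2 * (C + δ) := by linarith
    exact ((le_div_iff₀ hδ).2 this).trans (le_add_of_nonneg_right zero_le_one)
  refine ⟨l.map (thickening τ), ?_, ?_, ?_⟩
  · simp only [List.mem_map, forall_exists_index, and_imp, forall_apply_eq_imp_iff₂]
    intro A hA
    refine (ediam_thickening_le τ).trans ((add_le_add_left (hl A hA) _).trans ?_)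
    have : 2 * δ + 2 * τ ≤ 3 * δ := by linarith
    exact_mod_cast this
  · intro x hx
    obtain ⟨y, hy, hxy⟩ := mem_thickening_iff.1 (hLK hx)
    obtain ⟨A, hA, hyA⟩ := hc y hy
    exact ⟨_, List.mem_map_of_mem hA, mem_thickening_iff.2 ⟨y, hyA, hxy⟩⟩
  · have hsum : ∀ l : List (Set X), ((l.map (thickening τ)).map ediam).sum ≤
        (l.map ediam).sum + (l.length * (2 * τ) : ℝ≥0) := by
      intro l
      induction l with
      | nil => simp
      | cons A l ih =>
        simp only [List.map_cons, List.sum_cons, List.length_cons]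
        refine (add_le_add (ediam_thickening_le τ) ih).trans_eq ?_
        push_cast
        ring
    refine (hsum l).trans ((add_le_add_left hs _).trans ?_)
    rw [← ENNReal.coe_add, ENNReal.coe_le_coe]
    have : l.length * τ ≤ M * τ := by gcongr
    linarith

/-- A set which is approximated by continua of length less than `C` has length at most `C`. -/
theorem hausdorffMeasure_one_le_of_forall_exists_continuum {X : Type*} [MetricSpace X]
    [MeasurableSpace X] [BorelSpace X] {L : Set X} {C : ℝ≥0}
    (h : ∀ τ : ℝ≥0, 0 < τ → ∃ K : Set X, IsCompact K ∧ IsConnected K ∧ μH[1] K < C ∧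
      L ⊆ thickening τ K) :
    μH[1] L ≤ C := by
  obtain ⟨δ, -, hδ, hδ0⟩ := exists_seq_strictAnti_tendsto (0 : ℝ≥0)
  choose l hl hc hs using fun n => exists_list_cover_of_forall_exists_continuum (hδ n) h
  have hr : Tendsto (fun n => 3 * (δ n : ℝ≥0∞)) atTop (𝓝 0) := by
    have := ENNReal.tendsto_coe.2 (hδ0.const_mul 3)
    simpa using this
  refine (Measure.hausdorffMeasure_le_liminf_sum 1 L _ hr
    (fun n (i : Fin (l n).length) => (l n).get i)
    (.of_forall fun n i => hl n _ (List.get_mem _ _)) (.of_forall fun n x hx => ?_)).trans ?_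
  · obtain ⟨A, hA, hxA⟩ := hc n x hx
    obtain ⟨i, rfl⟩ := List.get_of_mem hA
    exact mem_iUnion.2 ⟨i, hxA⟩
  · have hlim : Tendsto (fun n => ((C + δ n : ℝ≥0) : ℝ≥0∞)) atTop (𝓝 C) := by
      have := ENNReal.tendsto_coe.2 (hδ0.const_add C)
      simpa using this
    rw [← hlim.liminf_eq]
    refine liminf_le_liminf (.of_forall fun n => ?_)
    simp only [ENNReal.rpow_one]
    refine le_of_eq_of_le ?_ (hs n)
    rw [← List.sum_ofFn]
    congr 1
    conv_rhs => rw [← List.ofFn_get (l n), List.map_ofFn]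
    rfl

/-- Gołąb's semicontinuity theorem: if nonempty compact connected sets `K n ⊆ ℝ^d`
converge in Hausdorff distance to a nonempty compact set `L`, then
`H¹(L) ≤ liminf H¹(K n)`. -/
theorem golab_semicontinuity
    (d : ℕ) (hd : 1 ≤ d)
    (K : ℕ → Set (EuclideanSpace ℝ (Fin d)))
    (hKne : ∀ n, (K n).Nonempty) (hKc : ∀ n, IsCompact (K n))
    (hKconn : ∀ n, IsConnected (K n))
    (L : Set (EuclideanSpace ℝ (Fin d)))
    (hLne : L.Nonempty) (hLc : IsCompact L)
    (hconv : Filter.Tendsto (fun n => Metric.hausdorffDist (K n) L)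
      Filter.atTop (nhds 0)) :
    μH[1] L ≤ Filter.liminf (fun n => μH[1] (K n)) Filter.atTop := by
  refine le_of_forall_gt_imp_ge_of_dense fun c hc => ?_
  obtain ⟨C, hC, hCc⟩ := ENNReal.lt_iff_exists_nnreal_btwn.1 hc
  refine le_trans ?_ hCc.le
  refine hausdorffMeasure_one_le_of_forall_exists_continuum fun τ hτ => ?_
  obtain ⟨n, hn, hnτ⟩ := ((frequently_lt_of_liminf_lt (by isBoundedDefault) hC).and_eventually
    (hconv.eventually_lt_const (NNReal.coe_pos.2 hτ))).exists
  refine ⟨K n, hKc n, hKconn n, hn, fun x hx => ?_⟩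
  obtain ⟨y, hy, hyx⟩ := exists_dist_lt_of_hausdorffDist_lt' hx hnτ
    (hausdorffEDist_ne_top_of_nonempty_of_bounded (hKne n) hLne (hKc n).isBounded hLc.isBounded)
  exact mem_thickening_iff.2 ⟨y, hy, by rwa [dist_comm]⟩
end

section
/- Let d ≥ 1, k ≥ 1, and let (K_n) be a sequence of nonempty compact subsets of ℝ^d converging in Hausdorff distance to a nonempty compact set K ⊆ ℝ^d. Assume that each K_n has at most k connected components. Then K has at most k connected components. -/
open Filter Metric Set Topology

/-- If every family of `k + 1` points of `L` has two members with the same value under `f`,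
then `f` takes at most `k` values on `L`. -/
theorem exists_finset_card_le_of_forall_fin_map_eq {α β : Type*} {f : α → β} {L : Set α} {k : ℕ}
    (h : ∀ p : Fin (k + 1) → α, (∀ i, p i ∈ L) → ∃ i j, i ≠ j ∧ f (p i) = f (p j)) :
    ∃ s : Finset β, s.card ≤ k ∧ ∀ x ∈ L, f x ∈ s := by
  have hle : (f '' L).encard ≤ k := by
    by_contra! hlt
    obtain ⟨t, htL, ht⟩ := exists_subset_encard_eq (Order.add_one_le_of_lt hlt)
    have hfin : t.Finite := finite_of_encard_eq_coe (k := k + 1) (by exact_mod_cast ht)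
    have hcard : hfin.toFinset.card = k + 1 := by
      rw [hfin.encard_eq_coe_toFinset_card] at ht
      exact_mod_cast ht
    let e := hfin.toFinset.equivFinOfCardEq hcard
    have hmem (i : Fin (k + 1)) : ∃ x ∈ L, f x = e.symm i :=
      htL (hfin.mem_toFinset.1 (e.symm i).2)
    choose p hpL hp using hmem
    obtain ⟨i, j, hij, hf⟩ := h p hpL
    rw [hp, hp] at hf
    exact hij (e.symm.injective (Subtype.ext hf))
  have hfin : (f '' L).Finite := finite_of_encard_le_coe hle
  refine ⟨hfin.toFinset, ?_, fun x hx => hfin.mem_toFinset.2 (mem_image_of_mem f hx)⟩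
  rw [hfin.encard_eq_coe_toFinset_card] at hle
  exact_mod_cast hle

/-- Points in distinct connected components of a compact set can be separated by a partition of
that set into two compact sets. -/
theorem IsCompact.exists_compact_partition_of_connectedComponentIn_ne {α : Type*}
    [TopologicalSpace α] [T2Space α] {L : Set α} (hL : IsCompact L) {x y : α} (hx : x ∈ L)
    (hy : y ∈ L) (hxy : connectedComponentIn L x ≠ connectedComponentIn L y) :
    ∃ C D : Set α, IsCompact C ∧ IsCompact D ∧ Disjoint C D ∧ C ∪ D = L ∧ x ∈ C ∧ y ∈ D := by
  have := isCompact_iff_compactSpace.1 hL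
  have hy' : (⟨y, hy⟩ : L) ∉ connectedComponent (⟨x, hx⟩ : L) := fun h => hxy <| by
    rw [connectedComponentIn_eq_image hx, connectedComponentIn_eq_image hy,
      connectedComponent_eq h]
  rw [connectedComponent_eq_iInter_isClopen, mem_iInter] at hy'
  push Not at hy'
  obtain ⟨⟨Z, hZ, hxZ⟩, hyZ⟩ := hy'
  refine ⟨(↑) '' Z, (↑) '' Zᶜ, hZ.isClosed.isCompact.image continuous_subtype_val,
    hZ.compl.isClosed.isCompact.image continuous_subtype_val,
    (disjoint_image_iff Subtype.val_injective).2 disjoint_compl_right, ?_,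
    ⟨_, hxZ, rfl⟩, ⟨_, hyZ, rfl⟩⟩
  rw [← image_union, union_compl_self, image_univ, Subtype.range_coe]

/-- A connected set close enough to a compact set `L` cannot come close to two points lying in
distinct connected components of `L`. -/
theorem IsCompact.eventually_not_ball_inter_of_connectedComponentIn_ne {α : Type*}
    [MetricSpace α] {L : Set α} (hL : IsCompact L) {x y : α} (hx : x ∈ L) (hy : y ∈ L)
    (hxy : connectedComponentIn L x ≠ connectedComponentIn L y) :
    ∀ᶠ ε in 𝓝[>] (0 : ℝ), ∀ A : Set α, IsPreconnected A → A ⊆ thickening ε L →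
      (A ∩ ball x ε).Nonempty → ¬(A ∩ ball y ε).Nonempty := by
  obtain ⟨C, D, hC, hD, hCD, rfl, hxC, hyD⟩ :=
    hL.exists_compact_partition_of_connectedComponentIn_ne hx hy hxy
  obtain ⟨δ, hδ, hdisj⟩ := hCD.exists_thickenings hC hD.isClosed
  filter_upwards [Ioo_mem_nhdsGT hδ] with ε hε A hA hAL hAx hAy
  replace hdisj := hdisj.mono (thickening_mono hε.2.le C) (thickening_mono hε.2.le D)
  rw [thickening_union] at hAL
  obtain ⟨z, -, hz⟩ := hA _ _ isOpen_thickening isOpen_thickening hAL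
    (hAx.mono (inter_subset_inter_right A (ball_subset_thickening hxC ε)))
    (hAy.mono (inter_subset_inter_right A (ball_subset_thickening hyD ε)))
  exact disjoint_left.1 hdisj hz.1 hz.2

/-- Upper semicontinuity of the number of connected components under Hausdorff
convergence: if nonempty compact sets `K n ⊆ ℝ^d`, each with at most `k` connected
components, converge in Hausdorff distance to a nonempty compact set `L`, then `L`
has at most `k` connected components. -/
theorem components_le_of_hausdorff_limit
    (d k : ℕ) (hd : 1 ≤ d) (hk : 1 ≤ k)
    (K : ℕ → Set (EuclideanSpace ℝ (Fin d)))
    (hKne : ∀ n, (K n).Nonempty) (hKc : ∀ n, IsCompact (K n))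
    (hKcomp : ∀ n, ∃ s : Finset (Set (EuclideanSpace ℝ (Fin d))),
      s.card ≤ k ∧ ∀ x ∈ K n, connectedComponentIn (K n) x ∈ s)
    (L : Set (EuclideanSpace ℝ (Fin d)))
    (hLne : L.Nonempty) (hLc : IsCompact L)
    (hconv : Filter.Tendsto (fun n => Metric.hausdorffDist (K n) L)
      Filter.atTop (nhds 0)) :
    ∃ s : Finset (Set (EuclideanSpace ℝ (Fin d))),
      s.card ≤ k ∧ ∀ x ∈ L, connectedComponentIn L x ∈ s := by
  refine exists_finset_card_le_of_forall_fin_map_eq fun p hp => ?_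
  by_contra! hne
  have hsep : ∀ᶠ ε in 𝓝[>] (0 : ℝ), ∀ i j, i ≠ j →
      ∀ A : Set (EuclideanSpace ℝ (Fin d)), IsPreconnected A → A ⊆ thickening ε L →
        (A ∩ ball (p i) ε).Nonempty → ¬(A ∩ ball (p j) ε).Nonempty := by
    simp_rw [eventually_all]
    exact fun i j hij =>
      hLc.eventually_not_ball_inter_of_connectedComponentIn_ne (hp i) (hp j) (hne i j hij)
  obtain ⟨ε, hε, hε0⟩ := (hsep.and self_mem_nhdsWithin).exists
  obtain ⟨n, hn⟩ := (hconv.eventually_lt_const hε0).exists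
  have hfin := hausdorffEDist_ne_top_of_nonempty_of_bounded (hKne n) hLne
    (hKc n).isBounded hLc.isBounded
  have hKL : K n ⊆ thickening ε L := fun z hz =>
    mem_thickening_iff.2 (exists_dist_lt_of_hausdorffDist_lt hz hn hfin)
  choose q hqK hq using fun i => exists_dist_lt_of_hausdorffDist_lt' (hp i) hn hfin
  obtain ⟨s, hs, hsK⟩ := hKcomp n
  obtain ⟨i, -, j, -, hij, heq⟩ := Finset.exists_ne_map_eq_of_card_lt_of_maps_to
    (s := Finset.univ) (t := s) (f := fun i => connectedComponentIn (K n) (q i))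
    (by simpa using Nat.lt_succ_of_le hs) (fun i _ => hsK _ (hqK i))
  refine hε i j hij (connectedComponentIn (K n) (q i)) isPreconnected_connectedComponentIn
    ((connectedComponentIn_subset _ _).trans hKL)
    ⟨q i, mem_connectedComponentIn (hqK i), hq i⟩ ⟨q j, ?_, hq j⟩
  exact heq ▸ mem_connectedComponentIn (hqK j)
end

section
/- Let d ≥ 1, let D ⊆ ℝ^d be a nonempty compact set, let λ > 0, and let G be a function assigning to each nonempty compact subset of D a nonnegative real number, which is lower semicontinuous with respect to Hausdorff convergence: whenever nonempty compact sets K_n ⊆ D converge in Hausdorff distance to a nonempty compact K ⊆ D, one has G(K) ≤ liminf_{n→∞} G(K_n). Then the minimum of Σ ↦ G(Σ) + λ H¹(Σ) (with values in [0, +∞]) over all nonempty compact connected subsets Σ of D is attained: there exists a nonempty compact connected Σ* ⊆ D with G(Σ*) + λ H¹(Σ*) ≤ G(Σ) + λ H¹(Σ) for every nonempty compact connected Σ ⊆ D. -/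
open scoped MeasureTheory

open Set Filter Topology TopologicalSpace

/-- `IsCluster U i s` says that the sets `U j`, `j ∈ s`, are the nodes of a tree with root `i` in
which neighbouring nodes intersect. -/
inductive IsCluster {X ι : Type*} [DecidableEq ι] (U : ι → Set X) : ι → Finset ι → Prop
  | single (i : ι) : IsCluster U i {i}
  | join {i j : ι} {s t : Finset ι} : IsCluster U i s → IsCluster U j t → Disjoint s t →
      (U i ∩ U j).Nonempty → IsCluster U i (s ∪ t)

/-- A tree of sets can be extended by a leaf. -/
theorem IsCluster.insert_leaf {X ι : Type*} [DecidableEq ι] {U : ι → Set X} {i k : ι} {s : Finset ι}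
    (h : IsCluster U i s) (hk : k ∉ s) (hU : ∃ j ∈ s, (U j ∩ U k).Nonempty) :
    IsCluster U i (insert k s) := by
  induction h with
  | single i =>
    obtain ⟨j, hj, hjk⟩ := hU
    obtain rfl := Finset.mem_singleton.1 hj
    rw [show insert k {j} = ({j} ∪ {k} : Finset ι) by ext; simp [or_comm]]
    exact .join (.single j) (.single k) (by simpa [eq_comm] using hk) hjk
  | @join i j s t h₁ h₂ hst hij ih₁ ih₂ =>
    rw [Finset.mem_union, not_or] at hk
    obtain ⟨l, hl, hlk⟩ := hU
    rcases Finset.mem_union.1 hl with hl | hl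
    · rw [← Finset.insert_union]
      exact .join (ih₁ hk.1 ⟨l, hl, hlk⟩) h₂ (Finset.disjoint_insert_left.2 ⟨hk.2, hst⟩) hij
    · rw [← Finset.union_insert]
      exact .join h₁ (ih₂ hk.2 ⟨l, hl, hlk⟩) (Finset.disjoint_insert_right.2 ⟨hk.1, hst⟩) hij

/-- A finite family of open sets covering a connected set and meeting it forms a tree. -/
theorem IsPreconnected.isCluster {X ι : Type*} [TopologicalSpace X] [DecidableEq ι] {K : Set X}
    (hK : IsPreconnected K) {U : ι → Set X} (hU : ∀ i, IsOpen (U i)) {F : Finset ι}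
    (hF : ∀ i ∈ F, (K ∩ U i).Nonempty) (hKF : K ⊆ ⋃ i ∈ F, U i) {i : ι} (hi : i ∈ F) :
    IsCluster U i F := by
  classical
  obtain ⟨s, hs⟩ := (F.powerset.filter (IsCluster U i)).exists_maximal
    ⟨{i}, by simpa [hi] using IsCluster.single i⟩
  have hsF : s ⊆ F := (Finset.mem_powerset.1 (Finset.mem_filter.1 hs.prop).1)
  have hsc : IsCluster U i s := (Finset.mem_filter.1 hs.prop).2
  have hne : s.Nonempty := by
    clear hs hsF hi
    induction hsc with
    | single => simp
    | join _ _ _ _ h _ => exact h.mono Finset.subset_union_left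
  by_cases hFs : F ⊆ s
  · rwa [hFs.antisymm hsF]
  obtain ⟨k, hkF, hks⟩ := Finset.not_subset.1 hFs
  obtain ⟨l, hl⟩ := hne
  obtain ⟨x, -, hx, hx'⟩ := hK (⋃ j ∈ s, U j) (⋃ j ∈ F \ s, U j)
    (isOpen_biUnion fun j _ => hU j) (isOpen_biUnion fun j _ => hU j)
    (fun x hx => by
      obtain ⟨j, hj, hxj⟩ := mem_iUnion₂.1 (hKF hx)
      by_cases hjs : j ∈ s
      · exact Or.inl (mem_iUnion₂.2 ⟨j, hjs, hxj⟩)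
      · exact Or.inr (mem_iUnion₂.2 ⟨j, Finset.mem_sdiff.2 ⟨hj, hjs⟩, hxj⟩))
    ((hF l (hsF hl)).mono (inter_subset_inter_right _ (subset_biUnion_of_mem (u := U) hl)))
    ((hF k hkF).mono (inter_subset_inter_right _
      (subset_biUnion_of_mem (u := U) (Finset.mem_coe.2 (Finset.mem_sdiff.2 ⟨hkF, hks⟩)))))
  obtain ⟨a, ha, hxa⟩ := mem_iUnion₂.1 hx
  obtain ⟨b, hb, hxb⟩ := mem_iUnion₂.1 hx'
  obtain ⟨hbF, hbs⟩ := Finset.mem_sdiff.1 hb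
  have hins : insert b s ∈ F.powerset.filter (IsCluster U i) :=
    Finset.mem_filter.2 ⟨Finset.mem_powerset.2 (Finset.insert_subset hbF hsF),
      hsc.insert_leaf hbs ⟨a, ha, x, hxa, hxb⟩⟩
  exact absurd (hs.le_of_ge hins (Finset.subset_insert b s) (Finset.mem_insert_self b s)) hbs

/-- A tree of small sets can be cut into pieces of diameter comparable with `δ`, apart from a
remainder which contains the root, at the price of counting one set twice per piece. -/
theorem IsCluster.exists_pieces {X ι : Type*} [PseudoMetricSpace X] [DecidableEq ι]
    {U : ι → Set X} {w : ι → ℝ} {η δ : ℝ} (hw : ∀ i, w i ≤ η)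
    (hU : ∀ i, ∀ x ∈ U i, ∀ y ∈ U i, dist x y ≤ w i) (hηδ : η ≤ δ)
    {i : ι} {s : Finset ι} (h : IsCluster U i s) :
    ∃ (l : List (Set X × ℝ)) (R : Set X) (ρ : ℝ), U i ⊆ R ∧
      (∀ x ∈ R, ∀ y ∈ R, dist x y ≤ ρ) ∧ ρ ≤ δ ∧
      (∀ p ∈ l, (∀ x ∈ p.1, ∀ y ∈ p.1, dist x y ≤ p.2) ∧ δ ≤ p.2 ∧ p.2 ≤ 2 * δ) ∧
      (∀ j ∈ s, ∀ x ∈ U j, x ∈ R ∨ ∃ p ∈ l, x ∈ p.1) ∧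
      ρ + (l.map Prod.snd).sum ≤ ∑ j ∈ s, w j + l.length * η := by
  induction h with
  | single i =>
    exact ⟨[], U i, w i, subset_rfl, hU i, (hw i).trans hηδ, by simp, by simp, by simp⟩
  | @join i j s t h₁ h₂ hst hij ih₁ ih₂ =>
    obtain ⟨l₁, R₁, ρ₁, hi, hR₁, hρ₁, hl₁, hc₁, hs₁⟩ := ih₁
    obtain ⟨l₂, R₂, ρ₂, hj, hR₂, hρ₂, hl₂, hc₂, hs₂⟩ := ih₂
    obtain ⟨z, hzi, hzj⟩ := hij
    have hz₁ := hi hzi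
    have hz₂ := hj hzj
    have hρ₁0 : 0 ≤ ρ₁ := dist_nonneg.trans (hR₁ z hz₁ z hz₁)
    have hρ₂0 : 0 ≤ ρ₂ := dist_nonneg.trans (hR₂ z hz₂ z hz₂)
    have hR : ∀ x ∈ R₁ ∪ R₂, ∀ y ∈ R₁ ∪ R₂, dist x y ≤ ρ₁ + ρ₂ := by
      rintro x (hx | hx) y (hy | hy)
      · linarith [hR₁ x hx y hy]
      · linarith [dist_triangle x z y, hR₁ x hx z hz₁, hR₂ z hz₂ y hy]
      · linarith [dist_triangle x z y, hR₂ x hx z hz₂, hR₁ z hz₁ y hy]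
      · linarith [hR₂ x hx y hy]
    have hl : ∀ p ∈ l₁ ++ l₂,
        (∀ x ∈ p.1, ∀ y ∈ p.1, dist x y ≤ p.2) ∧ δ ≤ p.2 ∧ p.2 ≤ 2 * δ := by
      intro p hp
      exact (List.mem_append.1 hp).elim (hl₁ p) (hl₂ p)
    have hc : ∀ k ∈ s ∪ t, ∀ x ∈ U k, x ∈ R₁ ∪ R₂ ∨ ∃ p ∈ l₁ ++ l₂, x ∈ p.1 := by
      intro k hk x hx
      rcases Finset.mem_union.1 hk with hk | hk
      · rcases hc₁ k hk x hx with h | ⟨p, hp, hxp⟩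
        · exact Or.inl (Or.inl h)
        · exact Or.inr ⟨p, List.mem_append_left _ hp, hxp⟩
      · rcases hc₂ k hk x hx with h | ⟨p, hp, hxp⟩
        · exact Or.inl (Or.inr h)
        · exact Or.inr ⟨p, List.mem_append_right _ hp, hxp⟩
    by_cases hle : ρ₁ + ρ₂ ≤ δ
    · refine ⟨l₁ ++ l₂, R₁ ∪ R₂, ρ₁ + ρ₂, hi.trans subset_union_left, hR, hle, hl, hc, ?_⟩
      rw [Finset.sum_union hst]
      simp only [List.map_append, List.sum_append, List.length_append, Nat.cast_add]
      linarith
    · refine ⟨(R₁ ∪ R₂, ρ₁ + ρ₂) :: (l₁ ++ l₂), U i, w i, subset_rfl, hU i,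
        (hw i).trans hηδ, ?_, ?_, ?_⟩
      · intro p hp
        rcases List.mem_cons.1 hp with rfl | hp
        · exact ⟨hR, by dsimp only; linarith, by dsimp only; linarith⟩
        · exact hl p hp
      · intro k hk x hx
        right
        rcases hc k hk x hx with h | ⟨p, hp, hxp⟩
        · exact ⟨_, List.mem_cons_self, h⟩
        · exact ⟨p, List.mem_cons_of_mem _ hp, hxp⟩
      · rw [Finset.sum_union hst]
        simp only [List.map_append, List.map_cons, List.sum_cons, List.sum_append,
          List.length_append, List.length_cons, Nat.cast_add, Nat.cast_one]
        linarith [hw i]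

/-- A compact set of finite length has finite open covers by small sets whose total diameter
is controlled by the length. -/
theorem IsCompact.exists_finite_open_cover_of_hausdorffMeasure_lt {X : Type*} [MetricSpace X]
    [MeasurableSpace X] [BorelSpace X] {K : Set X} (hK : IsCompact K) {W η : ℝ} (hη : 0 < η)
    (hW : μH[1] K < ENNReal.ofReal W) :
    ∃ (F : Finset ℕ) (U : ℕ → Set X) (w : ℕ → ℝ), (∀ i, IsOpen (U i)) ∧
      (∀ i, ∀ x ∈ U i, ∀ y ∈ U i, dist x y ≤ w i) ∧ (∀ i, w i ≤ η) ∧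
      (K ⊆ ⋃ i ∈ F, U i) ∧ (∀ i ∈ F, (K ∩ U i).Nonempty) ∧ ∑ i ∈ F, w i ≤ W := by
  classical
  rw [MeasureTheory.Measure.hausdorffMeasure_apply] at hW
  have hη' : 0 < ENNReal.ofReal (η / 2) := ENNReal.ofReal_pos.2 (half_pos hη)
  have hW' := (le_iSup₂ (f := fun (r : ENNReal) (_ : 0 < r) =>
    ⨅ (t : ℕ → Set X) (_ : K ⊆ ⋃ n, t n) (_ : ∀ n, Metric.ediam (t n) ≤ r),
      ∑' n, ⨆ _ : (t n).Nonempty, Metric.ediam (t n) ^ (1 : ℝ))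
    (ENNReal.ofReal (η / 2)) hη').trans_lt hW
  simp only [iInf_lt_iff] at hW'
  obtain ⟨t, hKt, htη, ht⟩ := hW'
  have hsup : ∀ n, (⨆ _ : (t n).Nonempty, Metric.ediam (t n) ^ (1 : ℝ)) = Metric.ediam (t n) := by
    intro n
    rcases (t n).eq_empty_or_nonempty with h | h
    · simp [h]
    · simp [h]
  simp only [hsup] at ht
  obtain ⟨e, he, hsum⟩ := ENNReal.exists_pos_sum_of_countable (tsub_pos_of_lt ht).ne' ℕ
  have hfin : ∀ n, Metric.ediam (t n) ≠ ⊤ := fun n => ((htη n).trans_lt ENNReal.ofReal_lt_top).ne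
  have hdiam : ∀ n, (Metric.ediam (t n)).toReal ≤ η / 2 := fun n =>
    ENNReal.toReal_le_of_le_ofReal (half_pos hη).le (htη n)
  set ρ : ℕ → ℝ := fun n => min (e n : ℝ) (η / 2) / 2 with hρ
  have hρ0 : ∀ n, 0 < ρ n := fun n => half_pos (lt_min (by exact_mod_cast he n) (half_pos hη))
  have hρe : ∀ n, 2 * ρ n ≤ e n := fun n => by
    have := min_le_left (e n : ℝ) (η / 2)
    simp only [hρ]; linarith
  have hρη : ∀ n, 2 * ρ n ≤ η / 2 := fun n => by
    have := min_le_right (e n : ℝ) (η / 2)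
    simp only [hρ]; linarith
  set U : ℕ → Set X := fun n => Metric.thickening (ρ n) (t n) with hUdef
  set w : ℕ → ℝ := fun n => (Metric.ediam (t n)).toReal + 2 * ρ n with hwdef
  have hUo : ∀ n, IsOpen (U n) := fun n => Metric.isOpen_thickening
  have hw0 : ∀ n, 0 ≤ w n := fun n => add_nonneg ENNReal.toReal_nonneg (by linarith [hρ0 n])
  obtain ⟨F, hF⟩ := hK.elim_finite_subcover U hUo
    (hKt.trans (iUnion_mono fun n => Metric.self_subset_thickening (hρ0 n) _))
  refine ⟨F.filter fun n => (K ∩ U n).Nonempty, U, w, hUo, ?_, ?_, ?_, ?_, ?_⟩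
  · intro n x hx y hy
    obtain ⟨x', hx', hxx⟩ := Metric.mem_thickening_iff.1 hx
    obtain ⟨y', hy', hyy⟩ := Metric.mem_thickening_iff.1 hy
    have h1 : dist x' y' ≤ (Metric.ediam (t n)).toReal := by
      rw [dist_edist]
      exact ENNReal.toReal_mono (hfin n) (Metric.edist_le_ediam_of_mem hx' hy')
    have h2 := dist_triangle4 x x' y' y
    rw [dist_comm y' y] at h2
    simp only [hwdef]; linarith
  · intro n
    simp only [hwdef]; linarith [hdiam n, hρη n]
  · intro x hx
    obtain ⟨n, hn, hxn⟩ := mem_iUnion₂.1 (hF hx)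
    exact mem_iUnion₂.2 ⟨n, Finset.mem_filter.2 ⟨hn, x, hx, hxn⟩, hxn⟩
  · intro n hn
    exact (Finset.mem_filter.1 hn).2
  · have hWpos : 0 < W := ENNReal.ofReal_pos.1 (pos_of_gt hW)
    rw [← ENNReal.ofReal_le_ofReal_iff hWpos.le, ENNReal.ofReal_sum_of_nonneg fun n _ => hw0 n]
    calc ∑ n ∈ F.filter fun n => (K ∩ U n).Nonempty, ENNReal.ofReal (w n)
        ≤ ∑' n, ENNReal.ofReal (w n) := ENNReal.sum_le_tsum _
      _ ≤ ∑' n, (Metric.ediam (t n) + e n) := by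
          refine ENNReal.tsum_le_tsum fun n => ?_
          rw [ENNReal.ofReal_add ENNReal.toReal_nonneg (by linarith [hρ0 n]),
            ENNReal.ofReal_toReal (hfin n)]
          gcongr
          rw [← ENNReal.ofReal_coe_nnreal]
          exact ENNReal.ofReal_le_ofReal (hρe n)
      _ = ∑' n, Metric.ediam (t n) + ∑' n, (e n : ENNReal) := ENNReal.tsum_add
      _ ≤ ∑' n, Metric.ediam (t n) + (ENNReal.ofReal W - ∑' n, Metric.ediam (t n)) := by gcongr
      _ = ENNReal.ofReal W := add_tsub_cancel_of_le ht.le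

/-- A compact connected set of length less than `W` can be covered by at most `2 W / δ + 1` sets
of diameter at most `2 δ` and of total diameter at most `W + ε`. -/
theorem IsConnected.exists_cover_of_hausdorffMeasure_lt {X : Type*} [MetricSpace X]
    [MeasurableSpace X] [BorelSpace X] {K : Set X} (hK : IsCompact K) (hKc : IsConnected K)
    {W δ ε : ℝ} (hδ : 0 < δ) (hε : 0 < ε) (hW : μH[1] K < ENNReal.ofReal W) :
    ∃ l : List (Set X × ℝ), (l.length : ℝ) ≤ 2 * W / δ + 1 ∧
      (∀ p ∈ l, (∀ x ∈ p.1, ∀ y ∈ p.1, dist x y ≤ p.2) ∧ 0 ≤ p.2 ∧ p.2 ≤ 2 * δ) ∧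
      (∀ x ∈ K, ∃ p ∈ l, x ∈ p.1) ∧ (l.map Prod.snd).sum ≤ W + ε := by
  have hWpos : 0 < W := ENNReal.ofReal_pos.1 (pos_of_gt hW)
  set M : ℝ := 2 * W / δ with hM
  have hMpos : 0 < M := by positivity
  set η : ℝ := min (δ / 2) (ε / M) with hη
  have hηpos : 0 < η := lt_min (half_pos hδ) (div_pos hε hMpos)
  have hηδ : η ≤ δ / 2 := min_le_left _ _
  have hηε : M * η ≤ ε := by
    calc M * η ≤ M * (ε / M) := by gcongr; exact min_le_right _ _
      _ = ε := by field_simp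
  obtain ⟨F, U, w, hUo, hU, hwη, hKF, hF, hsum⟩ :=
    hK.exists_finite_open_cover_of_hausdorffMeasure_lt hηpos hW
  obtain ⟨z, hz⟩ := hKc.nonempty
  obtain ⟨i, hi, -⟩ := mem_iUnion₂.1 (hKF hz)
  obtain ⟨l, R, ρ, hiR, hR, hρ, hl, hc, hs⟩ :=
    (hKc.isPreconnected.isCluster hUo hF hKF hi).exists_pieces hwη hU
      (show η ≤ δ by linarith)
  obtain ⟨u, -, hu⟩ := hF i hi
  have hρ0 : 0 ≤ ρ := dist_nonneg.trans (hR u (hiR hu) u (hiR hu))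
  have hlen : (l.length : ℝ) * δ ≤ (l.map Prod.snd).sum := by
    have := List.card_nsmul_le_sum (l.map Prod.snd) δ (by
      intro x hx
      obtain ⟨p, hp, rfl⟩ := List.mem_map.1 hx
      exact (hl p hp).2.1)
    simpa using this
  have hlM : (l.length : ℝ) ≤ M := by
    have h1 : (l.length : ℝ) * η ≤ l.length * (δ / 2) := by gcongr
    rw [hM, le_div_iff₀ hδ]
    linarith
  refine ⟨(R, ρ) :: l, ?_, ?_, ?_, ?_⟩
  · simpa using hlM
  · intro p hp
    rcases List.mem_cons.1 hp with rfl | hp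
    · exact ⟨hR, hρ0, by dsimp only; linarith⟩
    · exact ⟨(hl p hp).1, hδ.le.trans (hl p hp).2.1, (hl p hp).2.2⟩
  · intro x hx
    obtain ⟨j, hj, hxj⟩ := mem_iUnion₂.1 (hKF hx)
    rcases hc j hj x hxj with h | ⟨p, hp, hxp⟩
    · exact ⟨_, List.mem_cons_self, h⟩
    · exact ⟨p, List.mem_cons_of_mem _ hp, hxp⟩
  · have h1 : (l.length : ℝ) * η ≤ M * η := by gcongr
    simp only [List.map_cons, List.sum_cons]
    linarith

/-- **Gołąb's theorem**: the length is lower semicontinuous along sequences of compact connected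
sets which converge in the Hausdorff metric. -/
theorem hausdorffMeasure_one_le_of_tendsto {X : Type*} [MetricSpace X]
    [MeasurableSpace X] [BorelSpace X] {K : ℕ → NonemptyCompacts X} {L : NonemptyCompacts X}
    (hK : ∀ n, IsConnected (K n : Set X)) (hKL : Tendsto K atTop (𝓝 L)) {h : ENNReal}
    (hh : Tendsto (fun n => μH[1] (K n : Set X)) atTop (𝓝 h)) : μH[1] (L : Set X) ≤ h := by
  rcases eq_or_ne h ⊤ with rfl | htop
  · exact le_top
  have key : ∀ δ : ℝ, 0 < δ → ∃ l : List (Set X × ℝ),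
      (∀ p ∈ l, Metric.ediam p.1 ≤ ENNReal.ofReal p.2 ∧ 0 ≤ p.2 ∧ p.2 ≤ 3 * δ) ∧
      (∀ x ∈ L, ∃ p ∈ l, x ∈ p.1) ∧ (l.map Prod.snd).sum ≤ h.toReal + 3 * δ := by
    intro δ hδ
    set W : ℝ := h.toReal + δ with hWdef
    have hWpos : 0 < W := add_pos_of_nonneg_of_pos ENNReal.toReal_nonneg hδ
    have hhW : h < ENNReal.ofReal W := by
      rw [← ENNReal.ofReal_toReal htop]
      exact (ENNReal.ofReal_lt_ofReal_iff hWpos).2 (by linarith)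
    set N : ℝ := 2 * W / δ + 1 with hN
    have hN1 : 1 ≤ N := by
      have : 0 < 2 * W / δ := by positivity
      linarith
    set r : ℝ := δ / (2 * N) with hr
    have hrpos : 0 < r := by positivity
    have hrN : N * (2 * r) = δ := by rw [hr]; field_simp
    obtain ⟨n, hnW, hnr⟩ := ((hh.eventually_lt_const hhW).and
      (Metric.tendsto_nhds.1 hKL r hrpos)).exists
    obtain ⟨l, hlN, hl, hc, hs⟩ := (hK n).exists_cover_of_hausdorffMeasure_lt
      (K n).isCompact hδ hδ hnW
    refine ⟨l.map fun p => (Metric.thickening r p.1, p.2 + 2 * r), ?_, ?_, ?_⟩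
    · intro q hq
      obtain ⟨p, hp, rfl⟩ := List.mem_map.1 hq
      obtain ⟨hp1, hp2, hp3⟩ := hl p hp
      refine ⟨Metric.ediam_le fun x hx y hy => ?_, by dsimp only; linarith, ?_⟩
      · obtain ⟨x', hx', hxx⟩ := Metric.mem_thickening_iff.1 hx
        obtain ⟨y', hy', hyy⟩ := Metric.mem_thickening_iff.1 hy
        have h2 := dist_triangle4 x x' y' y
        rw [dist_comm y' y] at h2
        rw [edist_dist]
        exact ENNReal.ofReal_le_ofReal (by linarith [hp1 x' hx' y' hy'])
      · dsimp only
        nlinarith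
    · intro x hx
      have hfin : Metric.hausdorffEDist (K n : Set X) L ≠ ⊤ :=
        Metric.hausdorffEDist_ne_top_of_nonempty_of_bounded (K n).nonempty L.nonempty
          (K n).isCompact.isBounded L.isCompact.isBounded
      obtain ⟨y, hy, hyx⟩ := Metric.exists_dist_lt_of_hausdorffDist_lt' hx hnr hfin
      obtain ⟨p, hp, hyp⟩ := hc y hy
      exact ⟨_, List.mem_map_of_mem hp,
        Metric.mem_thickening_iff.2 ⟨y, hyp, by rwa [dist_comm]⟩⟩
    · have hsum : ((l.map fun p => (Metric.thickening r p.1, p.2 + 2 * r)).map Prod.snd).sum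
          = (l.map Prod.snd).sum + l.length * (2 * r) := by
        rw [List.map_map]
        simp [Function.comp_def, List.sum_map_add]
      have : (l.length : ℝ) * (2 * r) ≤ N * (2 * r) := by gcongr
      rw [hsum]
      linarith
  set δ : ℕ → ℝ := fun n => 1 / ((n : ℝ) + 1) with hδ
  have hδpos : ∀ n, 0 < δ n := fun n => by positivity
  have hδlim : Tendsto (fun n => 3 * δ n) atTop (𝓝 0) := by
    simpa [hδ] using tendsto_one_div_add_atTop_nhds_zero_nat.const_mul (3 : ℝ)
  choose l hl hc hs using fun n => key (δ n) (hδpos n)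
  have hbound := MeasureTheory.Measure.hausdorffMeasure_le_liminf_sum 1 (L : Set X)
    (l := atTop) (fun n => ENNReal.ofReal (3 * δ n))
    (by simpa using ENNReal.tendsto_ofReal hδlim)
    (fun n (i : Fin (l n).length) => ((l n).get i).1)
    (Eventually.of_forall fun n i => (hl n _ (List.get_mem _ i)).1.trans
      (ENNReal.ofReal_le_ofReal (hl n _ (List.get_mem _ i)).2.2))
    (Eventually.of_forall fun n x hx => by
      obtain ⟨p, hp, hxp⟩ := hc n x hx
      obtain ⟨i, rfl⟩ := List.mem_iff_get.1 hp
      exact mem_iUnion.2 ⟨i, hxp⟩)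
  refine hbound.trans ?_
  have hlim : Tendsto (fun n => ENNReal.ofReal (h.toReal + 3 * δ n)) atTop (𝓝 h) := by
    have := ENNReal.tendsto_ofReal (hδlim.const_add h.toReal)
    rwa [add_zero, ENNReal.ofReal_toReal htop] at this
  rw [← hlim.liminf_eq]
  refine liminf_le_liminf (Eventually.of_forall fun n => ?_)
  calc ∑ i : Fin (l n).length, Metric.ediam ((l n).get i).1 ^ (1 : ℝ)
      ≤ ∑ i : Fin (l n).length, ENNReal.ofReal ((l n).get i).2 := by
        refine Finset.sum_le_sum fun i _ => ?_
        rw [ENNReal.rpow_one]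
        exact (hl n _ (List.get_mem _ i)).1
    _ = ENNReal.ofReal ((l n).map Prod.snd).sum := by
        rw [← ENNReal.ofReal_sum_of_nonneg fun i _ => (hl n _ (List.get_mem _ i)).2.1]
        congr 1
        rw [← Fin.sum_univ_getElem, ← Fin.sum_congr' _ (List.length_map Prod.snd)]
        simp
    _ ≤ ENNReal.ofReal (h.toReal + 3 * δ n) := ENNReal.ofReal_le_ofReal (hs n)

/-- Connectedness is stable under convergence in the Hausdorff metric. -/
theorem isClosed_setOf_isConnected_nonemptyCompacts {X : Type*} [MetricSpace X] :
    IsClosed {K : NonemptyCompacts X | IsConnected (K : Set X)} := by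
  rw [← isOpen_compl_iff, isOpen_iff_mem_nhds]
  intro L hL
  have hL' : ¬ IsPreconnected (L : Set X) := fun h => hL ⟨L.nonempty, h⟩
  rw [isPreconnected_closed_iff] at hL'
  push Not at hL'
  obtain ⟨A, B, hA, hB, hAB, hLA, hLB, hdis⟩ := hL'
  obtain ⟨U, V, hU, hV, hAU, hBV, hUV⟩ :=
    SeparatedNhds.of_isCompact_isCompact (L.isCompact.inter_right hA) (L.isCompact.inter_right hB)
      (disjoint_iff_inter_eq_empty.2 (by rw [← inter_inter_distrib_left, hdis]))
  filter_upwards [(NonemptyCompacts.isOpen_subsets_of_isOpen (hU.union hV)).mem_nhds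
      (show (L : Set X) ⊆ U ∪ V from fun x hx =>
        (hAB hx).imp (fun h => hAU ⟨hx, h⟩) fun h => hBV ⟨hx, h⟩),
    (NonemptyCompacts.isOpen_inter_nonempty_of_isOpen hU).mem_nhds
      (show ((L : Set X) ∩ U).Nonempty from hLA.mono fun x hx => ⟨hx.1, hAU hx⟩),
    (NonemptyCompacts.isOpen_inter_nonempty_of_isOpen hV).mem_nhds
      (show ((L : Set X) ∩ V).Nonempty from hLB.mono fun x hx => ⟨hx.1, hBV hx⟩)]
    with K h1 h2 h3 hK
  obtain ⟨x, -, hxU, hxV⟩ := hK.isPreconnected U V hU hV h1 h2 h3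
  exact disjoint_left.1 hUV hxU hxV

/-- Existence of a minimizer of the penalized shape functional `G(Σ) + λ H¹(Σ)`
over nonempty compact connected subsets of a nonempty compact set `D ⊆ ℝ^d`,
for `G` nonnegative and lower semicontinuous with respect to Hausdorff convergence. -/
theorem exists_minimizer_connected_penalized
    (d : ℕ) (hd : 1 ≤ d)
    (D : Set (EuclideanSpace ℝ (Fin d))) (hDne : D.Nonempty) (hDc : IsCompact D)
    (lam : ℝ) (hlam : 0 < lam)
    (G : Set (EuclideanSpace ℝ (Fin d)) → ℝ)
    (hGnonneg : ∀ K, K ⊆ D → K.Nonempty → IsCompact K → 0 ≤ G K)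
    (hGlsc : ∀ (K : ℕ → Set (EuclideanSpace ℝ (Fin d)))
      (L : Set (EuclideanSpace ℝ (Fin d))),
      (∀ n, K n ⊆ D) → (∀ n, (K n).Nonempty) → (∀ n, IsCompact (K n)) →
      L ⊆ D → L.Nonempty → IsCompact L →
      Filter.Tendsto (fun n => Metric.hausdorffDist (K n) L) Filter.atTop (nhds 0) →
      G L ≤ Filter.liminf (fun n => G (K n)) Filter.atTop) :
    ∃ S : Set (EuclideanSpace ℝ (Fin d)),
      S ⊆ D ∧ S.Nonempty ∧ IsCompact S ∧ IsConnected S ∧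
      ∀ T : Set (EuclideanSpace ℝ (Fin d)),
        T ⊆ D → T.Nonempty → IsCompact T → IsConnected T →
        ENNReal.ofReal (G S) + ENNReal.ofReal lam * μH[1] S ≤
          ENNReal.ofReal (G T) + ENNReal.ofReal lam * μH[1] T := by
  set C : Set (NonemptyCompacts (EuclideanSpace ℝ (Fin d))) :=
    {K | (K : Set (EuclideanSpace ℝ (Fin d))) ⊆ D} ∩
      {K | IsConnected (K : Set (EuclideanSpace ℝ (Fin d)))}
  have hCc : IsCompact C := (NonemptyCompacts.isCompact_subsets_of_isCompact hDc).inter_right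
    isClosed_setOf_isConnected_nonemptyCompacts
  set cost : NonemptyCompacts (EuclideanSpace ℝ (Fin d)) → ENNReal := fun K =>
    ENNReal.ofReal (G K) + ENNReal.ofReal lam * μH[1] (K : Set (EuclideanSpace ℝ (Fin d)))
    with hcost
  obtain ⟨z, hz⟩ := hDne
  have hzC : ({z} : NonemptyCompacts (EuclideanSpace ℝ (Fin d))) ∈ C :=
    ⟨by simpa using hz, by simpa using isConnected_singleton⟩
  have hzfin : cost {z} ≠ ⊤ := by
    have := MeasureTheory.Measure.nullSingletonClass_hausdorff (EuclideanSpace ℝ (Fin d)) one_pos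
    simp [hcost]
  obtain ⟨u, -, hulim, huC⟩ := exists_seq_tendsto_sInf (S := cost '' C) ⟨_, _, hzC, rfl⟩
    (OrderBot.bddBelow _)
  choose K hKC hKu using huC
  have hmfin : sInf (cost '' C) ≠ ⊤ :=
    ((sInf_le (mem_image_of_mem cost hzC)).trans_lt hzfin.lt_top).ne
  obtain ⟨⟨L, g, h⟩, ⟨hLC, -⟩, φ, hφ, hlim⟩ := (hCc.prod isCompact_univ).tendsto_subseq
    (x := fun n => (K n, ENNReal.ofReal (G (K n)),
      μH[1] (K n : Set (EuclideanSpace ℝ (Fin d))))) fun n => ⟨hKC n, mem_univ _⟩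
  rw [Prod.tendsto_iff, Prod.tendsto_iff] at hlim
  obtain ⟨hlimL, hlimg, hlimh⟩ := hlim
  have hsplit : sInf (cost '' C) = g + ENNReal.ofReal lam * h := by
    refine tendsto_nhds_unique (hulim.comp hφ.tendsto_atTop) ?_
    have := hlimg.add (ENNReal.Tendsto.const_mul (a := ENNReal.ofReal lam) hlimh
      (Or.inr ENNReal.ofReal_ne_top))
    exact this.congr fun n => hKu (φ n)
  have hgfin : g ≠ ⊤ := by
    rintro rfl
    exact hmfin (by simp [hsplit])
  have hGL : ENNReal.ofReal (G L) ≤ g := by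
    refine ENNReal.ofReal_le_of_le_toReal ?_
    have hGlim : Tendsto (fun n => G (K (φ n))) atTop (𝓝 g.toReal) :=
      ((ENNReal.tendsto_toReal hgfin).comp hlimg).congr fun n =>
        ENNReal.toReal_ofReal (hGnonneg _ (hKC _).1 (K _).nonempty (K _).isCompact)
    rw [← hGlim.liminf_eq]
    exact hGlsc (fun n => K (φ n)) L (fun n => (hKC _).1) (fun n => (K _).nonempty)
      (fun n => (K _).isCompact) hLC.1 L.nonempty L.isCompact
      (tendsto_iff_dist_tendsto_zero.1 hlimL)
  have hHL : μH[1] (L : Set (EuclideanSpace ℝ (Fin d))) ≤ h :=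
    hausdorffMeasure_one_le_of_tendsto (fun n => (hKC (φ n)).2) hlimL hlimh
  refine ⟨L, hLC.1, L.nonempty, L.isCompact, hLC.2, fun T hTD hTne hTc hTconn => ?_⟩
  calc ENNReal.ofReal (G L) + ENNReal.ofReal lam * μH[1] (L : Set (EuclideanSpace ℝ (Fin d)))
      ≤ g + ENNReal.ofReal lam * h := by gcongr
    _ = sInf (cost '' C) := hsplit.symm
    _ ≤ cost ⟨⟨T, hTc⟩, hTne⟩ := sInf_le (mem_image_of_mem cost ⟨hTD, hTconn⟩)
    _ = _ := rfl
end
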